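/- Let (Ω,P) be a probability space, let C : Ω → ℝ^d be measurable, and let (U, U_Y) : Ω → ℝ^m × ℝ have a centered multivariate Gaussian law on ℝ^{m+1} with Cov(U) = Σ_UU positive definite and σ_UY := (Cov(U_i, U_Y))_{i=1..m}, with C independent of (U, U_Y). Let f : ℝ^d → ℝ^m be measurable and set X := f(C) + U (componentwise). Then the conditional expectation of U_Y given the σ-algebra generated by (C, X) satisfies E[U_Y | σ(C, X)] = σ_UYᵀ Σ_UU^{-1} (X − f ∘ C) almost surely. -/

import Mathlib

open MeasureTheory ProbabilityTheory Matrix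

/-- The standard Gaussian product measure on `ℝ^n`. -/
noncomputable def stdGaussianPi (n : ℕ) : Measure (Fin n → ℝ) :=
  Measure.pi fun _ => gaussianReal 0 1

/-- `μ` is the centered multivariate Gaussian measure on `ℝ^n` with covariance matrix `S`. -/
def IsCenteredGaussian {n : ℕ} (μ : Measure (Fin n → ℝ))
    (S : Matrix (Fin n) (Fin n) ℝ) : Prop :=
  ∃ A : Matrix (Fin n) (Fin n) ℝ, S = A * Aᵀ ∧ μ = (stdGaussianPi n).map A.mulVec

section GaussianRegression

variable {n : ℕ}

lemma isGaussian_stdGaussianPi (n : ℕ) : IsGaussian (stdGaussianPi n) := by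
  have h : HasGaussianLaw (fun (x : Fin n → ℝ) i => x i) (stdGaussianPi n) :=
    iIndepFun.hasGaussianLaw (fun i => HasLaw.hasGaussianLaw
      (measurePreserving_eval (fun _ : Fin n => gaussianReal 0 1) i).hasLaw)
      (iIndepFun_pi (X := fun _ (y : ℝ) => y) fun _ => by fun_prop)
  simpa using h.isGaussian_map

lemma memLp_eval_stdGaussianPi (i : Fin n) :
    MemLp (fun x : Fin n → ℝ => x i) 2 (stdGaussianPi n) :=
  have := isGaussian_stdGaussianPi n
  (IsGaussian.hasGaussianLaw_id (μ := stdGaussianPi n)).eval i |>.memLp_two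

lemma hasLaw_eval_stdGaussianPi (i : Fin n) :
    HasLaw (fun x : Fin n → ℝ => x i) (gaussianReal 0 1) (stdGaussianPi n) :=
  (measurePreserving_eval (fun _ : Fin n => gaussianReal 0 1) i).hasLaw

lemma integral_eval_stdGaussianPi (i : Fin n) : ∫ x, x i ∂(stdGaussianPi n) = 0 := by
  rw [(hasLaw_eval_stdGaussianPi i).integral_eq, integral_id_gaussianReal]

lemma covariance_eval_stdGaussianPi (i j : Fin n) :
    cov[fun x => x i, fun x => x j; stdGaussianPi n] = (1 : Matrix (Fin n) (Fin n) ℝ) i j := by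
  have := isGaussian_stdGaussianPi n
  by_cases hij : i = j
  · subst hij
    rw [covariance_self (measurable_pi_apply i).aemeasurable, one_apply_eq,
      (hasLaw_eval_stdGaussianPi i).variance_eq, variance_id_gaussianReal]
    rfl
  · rw [one_apply_ne hij]
    refine IndepFun.covariance_eq_zero ?_ (memLp_eval_stdGaussianPi i)
      (memLp_eval_stdGaussianPi j)
    exact (iIndepFun_pi (μ := fun _ : Fin n => gaussianReal 0 1)
      (X := fun _ (y : ℝ) => y) (fun _ => by fun_prop)).indepFun hij

lemma isGaussian_map_mulVec_stdGaussianPi (A : Matrix (Fin n) (Fin n) ℝ) :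
    IsGaussian ((stdGaussianPi n).map A.mulVec) := by
  have := isGaussian_stdGaussianPi n
  exact inferInstanceAs
    (IsGaussian ((stdGaussianPi n).map (LinearMap.toContinuousLinearMap A.mulVecLin)))

lemma IsCenteredGaussian.isGaussian {μ : Measure (Fin n → ℝ)} {S : Matrix (Fin n) (Fin n) ℝ}
    (h : IsCenteredGaussian μ S) : IsGaussian μ := by
  obtain ⟨A, -, rfl⟩ := h
  exact isGaussian_map_mulVec_stdGaussianPi A

lemma IsCenteredGaussian.isSymm {μ : Measure (Fin n → ℝ)} {S : Matrix (Fin n) (Fin n) ℝ}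
    (h : IsCenteredGaussian μ S) : S.IsSymm := by
  obtain ⟨A, rfl, -⟩ := h
  exact isSymm_mul_transpose_self A

lemma IsCenteredGaussian.integral_eval {μ : Measure (Fin n → ℝ)} {S : Matrix (Fin n) (Fin n) ℝ}
    (h : IsCenteredGaussian μ S) (i : Fin n) : ∫ x, x i ∂μ = 0 := by
  obtain ⟨A, -, rfl⟩ := h
  have := isGaussian_stdGaussianPi n
  rw [integral_map (f := fun x : Fin n → ℝ => x i) (by fun_prop)
    (measurable_pi_apply i).aestronglyMeasurable]
  simp only [mulVec, dotProduct]
  rw [integral_finsetSum _ fun k _ =>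
    ((memLp_eval_stdGaussianPi k).integrable one_le_two).const_mul _]
  simp [integral_const_mul, integral_eval_stdGaussianPi]

lemma IsCenteredGaussian.covariance_eval {μ : Measure (Fin n → ℝ)}
    {S : Matrix (Fin n) (Fin n) ℝ} (h : IsCenteredGaussian μ S) (i j : Fin n) :
    cov[fun x => x i, fun x => x j; μ] = S i j := by
  obtain ⟨A, rfl, rfl⟩ := h
  have := isGaussian_stdGaussianPi n
  rw [covariance_map_fun (measurable_pi_apply i).aestronglyMeasurable
    (measurable_pi_apply j).aestronglyMeasurable (by fun_prop)]
  simp only [mulVec, dotProduct]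
  rw [covariance_fun_sum_fun_sum (fun k => (memLp_eval_stdGaussianPi k).const_mul _)
    (fun k => (memLp_eval_stdGaussianPi k).const_mul _)]
  simp [covariance_const_mul_left, covariance_const_mul_right, covariance_eval_stdGaussianPi,
    one_apply, mul_apply, mul_comm]

/-- If `X` is independent of `(Y, Z)` and `Y` is independent of `Z`, then `(X, Y)` is independent
of `Z`. -/
lemma IndepFun.prodMk_left_of_prodMk_right {Ω α β γ : Type*} [MeasurableSpace Ω]
    [MeasurableSpace α] [MeasurableSpace β] [MeasurableSpace γ] {P : Measure Ω}
    [IsProbabilityMeasure P] {X : Ω → α} {Y : Ω → β} {Z : Ω → γ}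
    (hX : Measurable X) (hY : Measurable Y) (hZ : Measurable Z)
    (h : IndepFun X (fun ω => (Y ω, Z ω)) P) (hYZ : IndepFun Y Z P) :
    IndepFun (fun ω => (X ω, Y ω)) Z P := by
  have hXY : IndepFun X Y P := h.comp measurable_id measurable_fst
  rw [indepFun_iff_map_prod_eq_prod_map_map (by fun_prop) (by fun_prop)] at h hXY hYZ ⊢
  apply MeasurableEquiv.prodAssoc.map_measurableEquiv_injective
  have := Measure.isProbabilityMeasure_map (μ := P) hX.aemeasurable
  have := Measure.isProbabilityMeasure_map (μ := P) hY.aemeasurable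
  have := Measure.isProbabilityMeasure_map (μ := P) hZ.aemeasurable
  rw [hXY, Measure.prodAssoc_prod, ← hYZ, ← h,
    Measure.map_map MeasurableEquiv.prodAssoc.measurable (by fun_prop)]
  rfl

/-- The residual of the linear regression of the last coordinate of a centered Gaussian vector on
the other coordinates is independent of these coordinates. -/
lemma IsCenteredGaussian.indepFun_sub_regression {m : ℕ} {μ : Measure (Fin (m + 1) → ℝ)}
    {S : Matrix (Fin (m + 1)) (Fin (m + 1)) ℝ} (h : IsCenteredGaussian μ S) {w : Fin m → ℝ}
    (hw : w ᵥ* S.submatrix Fin.castSucc Fin.castSucc = fun i => S (Fin.castSucc i) (Fin.last m)) :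
    IndepFun (fun (x : Fin (m + 1) → ℝ) (i : Fin m) => x (Fin.castSucc i))
      (fun x => x (Fin.last m) - ∑ i, w i * x (Fin.castSucc i)) μ := by
  have := h.isGaussian
  have hid : HasGaussianLaw (fun x : Fin (m + 1) → ℝ => x) μ := IsGaussian.hasGaussianLaw_id
  have hmem (i : Fin (m + 1)) : MemLp (fun x : Fin (m + 1) → ℝ => x i) 2 μ :=
    (hid.eval i).memLp_two
  let L : (Fin (m + 1) → ℝ) →L[ℝ] (Fin m → ℝ) × (Unit → ℝ) :=
    (ContinuousLinearMap.pi fun i => .proj (Fin.castSucc i)).prod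
      (ContinuousLinearMap.pi fun _ =>
        .proj (Fin.last m) - ∑ i, w i • .proj (Fin.castSucc i))
  have hL : HasGaussianLaw (fun x : Fin (m + 1) → ℝ => (fun i : Fin m => x (Fin.castSucc i),
      fun _ : Unit => x (Fin.last m) - ∑ i, w i * x (Fin.castSucc i))) μ := by
    have hL_eq : L = fun x : Fin (m + 1) → ℝ => (fun i : Fin m => x (Fin.castSucc i),
        fun _ : Unit => x (Fin.last m) - ∑ i, w i * x (Fin.castSucc i)) := by
      ext <;> simp [L]
    rw [← hL_eq]
    exact hid.map_fun L
  refine (hL.indepFun_of_covariance_eval (X := fun i (x : Fin (m + 1) → ℝ) => x (Fin.castSucc i))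
    (Y := fun _ (x : Fin (m + 1) → ℝ) => x (Fin.last m) - ∑ i, w i * x (Fin.castSucc i)) fun j _ => ?_).comp
    measurable_id (measurable_pi_apply ())
  rw [covariance_comm, covariance_fun_sub_left (hmem _)
    (memLp_finsetSum _ fun i _ => (hmem _).const_mul _) (hmem _),
    covariance_fun_sum_left (fun i => (hmem _).const_mul _) (hmem _)]
  simp only [covariance_const_mul_left, h.covariance_eval]
  have hj := congrFun hw j
  simp only [vecMul, dotProduct, submatrix_apply] at hj
  rw [hj, ← h.isSymm.apply, sub_self]

end GaussianRegression

/-- Conditional expectation of the outcome noise given covariates and non-intervened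
treatments: if `(U, U_Y)` is centered multivariate Gaussian on `ℝ^{m+1}` with
`Cov(U) = Σ_UU` positive definite and `σ_UY = (Cov(U_i, U_Y))_i`, `C` is independent of
`(U, U_Y)`, and `X = f(C) + U`, then
`E[U_Y | σ(C, X)] = σ_UYᵀ Σ_UU⁻¹ (X − f(C))` a.s.
Index convention: `U` occupies indices `Fin.castSucc i`, `U_Y` the index `Fin.last m`. -/
theorem condexp_outcome_noise_given_covariates_and_treatments
    {Ω : Type*} [MeasurableSpace Ω] (P : Measure Ω) [IsProbabilityMeasure P]
    (d m : ℕ)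
    (C : Ω → Fin d → ℝ) (hC : Measurable C)
    (N : Ω → Fin (m + 1) → ℝ) (hN : Measurable N)
    (S : Matrix (Fin (m + 1)) (Fin (m + 1)) ℝ)
    (hlaw : IsCenteredGaussian (P.map N) S)
    (hpos : (S.submatrix (Fin.castSucc : Fin m → Fin (m + 1)) Fin.castSucc).PosDef)
    (hindep : IndepFun C N P)
    (f : (Fin d → ℝ) → Fin m → ℝ) (hf : Measurable f)
    (X : Ω → Fin m → ℝ) (hX : X = fun ω i => f (C ω) i + N ω (Fin.castSucc i)) :
    P[fun ω => N ω (Fin.last m)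
        | MeasurableSpace.comap (fun ω => (C ω, X ω)) inferInstance]
      =ᵐ[P] fun ω =>
        dotProduct (fun i : Fin m => S (Fin.castSucc i) (Fin.last m))
          ((S.submatrix (Fin.castSucc : Fin m → Fin (m + 1)) Fin.castSucc)⁻¹.mulVec
            (fun i => X ω i - f (C ω) i)) := by
  set T := S.submatrix (Fin.castSucc : Fin m → Fin (m + 1)) Fin.castSucc
  set w : Fin m → ℝ := (fun i : Fin m => S (Fin.castSucc i) (Fin.last m)) ᵥ* T⁻¹ with hw
  have hwT : w ᵥ* T = fun i => S (Fin.castSucc i) (Fin.last m) := by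
    rw [hw, vecMul_vecMul, nonsing_inv_mul _ hpos.det_pos.ne'.isUnit, vecMul_one]
  set U : Ω → Fin m → ℝ := fun ω i => N ω (Fin.castSucc i)
  set R : Ω → ℝ := fun ω => N ω (Fin.last m) - ∑ i, w i * N ω (Fin.castSucc i) with hR
  have hUm : Measurable U := by fun_prop
  have hRm : Measurable R := by fun_prop
  have hXm : Measurable X := by rw [hX]; fun_prop
  have hUR : IndepFun U R P := by
    have h := hlaw.indepFun_sub_regression hwT
    rw [indepFun_iff_map_prod_eq_prod_map_map (Measurable.aemeasurable (by fun_prop))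
      (Measurable.aemeasurable (by fun_prop))] at h ⊢
    rwa [Measure.map_map (by fun_prop) hN, Measure.map_map (by fun_prop) hN,
      Measure.map_map (by fun_prop) hN] at h
  have hCUR : IndepFun C (fun ω => (U ω, R ω)) P :=
    hindep.comp (φ := id)
      (ψ := fun x : Fin (m + 1) → ℝ => (fun i : Fin m => x (Fin.castSucc i),
        x (Fin.last m) - ∑ i, w i * x (Fin.castSucc i))) measurable_id (by fun_prop)
  have hRCX : IndepFun R (fun ω => (C ω, X ω)) P := by
    have h := (IndepFun.prodMk_left_of_prodMk_right hC hUm hRm hCUR hUR).symm.comp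
      (φ := id) (ψ := fun p : (Fin d → ℝ) × (Fin m → ℝ) => (p.1, f p.1 + p.2))
      measurable_id (by fun_prop)
    rw [hX]
    exact h
  have hint (i : Fin (m + 1)) : Integrable (fun ω => N ω i) P := by
    have := hlaw.isGaussian
    exact ((IsGaussian.hasGaussianLaw (X := N) (P := P)).eval i).integrable
  have hmean (i : Fin (m + 1)) : ∫ ω, N ω i ∂P = 0 := by
    rw [← hlaw.integral_eval i, integral_map hN.aemeasurable
      (measurable_pi_apply i).aestronglyMeasurable]
  have hintS : Integrable (fun ω => ∑ i, w i * N ω (Fin.castSucc i)) P :=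
    integrable_finsetSum _ fun i _ => (hint _).const_mul _
  have hRmean : ∫ ω, R ω ∂P = 0 := by
    rw [hR, integral_sub (hint _) hintS,
      integral_finsetSum _ fun i _ => (hint _).const_mul _]
    simp [integral_const_mul, hmean]
  have hle : MeasurableSpace.comap (fun ω => (C ω, X ω)) inferInstance ≤ ‹MeasurableSpace Ω› :=
    (hC.prodMk hXm).comap_le
  have hlin : (fun ω => ∑ i, w i * N ω (Fin.castSucc i)) = fun ω =>
      dotProduct (fun i : Fin m => S (Fin.castSucc i) (Fin.last m))
        (T⁻¹.mulVec (fun i => X ω i - f (C ω) i)) := by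
    ext ω
    rw [dotProduct_mulVec, ← hw, hX]
    simp [dotProduct]
  have hmeas : StronglyMeasurable[MeasurableSpace.comap (fun ω => (C ω, X ω)) inferInstance]
      (fun ω => ∑ i, w i * N ω (Fin.castSucc i)) := by
    have hg : Measurable fun p : (Fin d → ℝ) × (Fin m → ℝ) => ∑ i, w i * (p.2 i - f p.1 i) := by
      fun_prop
    have h := (hg.comp (comap_measurable fun ω => (C ω, X ω))).stronglyMeasurable
    convert h using 2 with ω
    simp [hX]
  have hsplit : (fun ω => N ω (Fin.last m)) =
      R + fun ω => ∑ i, w i * N ω (Fin.castSucc i) := by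
    ext ω
    simp [hR]
  rw [← hlin, hsplit]
  have hRint : Integrable R P := (hint _).sub hintS
  refine (condExp_add hRint hintS _).trans ?_
  rw [condExp_of_stronglyMeasurable hle hmeas hintS]
  filter_upwards [condExp_indep_eq hRm.comap_le hle
    (comap_measurable R).stronglyMeasurable hRCX] with ω hω
  rw [Pi.add_apply, hω, hRmean, zero_add]
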